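/- arXiv:2409.01800 — 4 statements merged into one kernel-verified Lean document; each statement's English description precedes it below -/
import Mathlib

section
/- Let K be a field, V a finite-dimensional K-vector space, l a natural number, and N : V → V a K-linear endomorphism with N^{l+1} = 0. Then N shifts Deligne's weight filtration of N centered at l by −2: for every integer k one has N(W_k V) ⊆ W_{k−2} V. -/
/-- Deligne's weight filtration of a nilpotent endomorphism `N` (with `N ^ (l + 1) = 0`)
centered at `l`: `W k = Σ_{i - j = k - l} (ker N^(i+1) ⊓ im N^j)`. -/
def weightFiltration {K V : Type*} [Field K] [AddCommGroup V] [Module K V]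
    (N : V →ₗ[K] V) (l : ℕ) (k : ℤ) : Submodule K V :=
  ⨆ p : ℕ × ℕ, ⨆ _ : (p.1 : ℤ) - (p.2 : ℤ) = k - (l : ℤ),
    LinearMap.ker (N ^ (p.1 + 1)) ⊓ LinearMap.range (N ^ p.2)

/-- `N` shifts its weight filtration centered at `l` by `-2`. -/
theorem weightFiltration_map_le {K V : Type*} [Field K] [AddCommGroup V] [Module K V]
    [FiniteDimensional K V] (N : V →ₗ[K] V) (l : ℕ) (hN : N ^ (l + 1) = 0) (k : ℤ) :
    Submodule.map N (weightFiltration N l k) ≤ weightFiltration N l (k - 2) := by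
  rw [weightFiltration, Submodule.map_iSup]
  refine iSup_le fun p => ?_
  rw [Submodule.map_iSup]
  refine iSup_le fun hp => ?_
  obtain ⟨i, j⟩ := p
  rintro _ ⟨x, ⟨hx, y, hy⟩, rfl⟩
  have hx' : (N ^ (i + 1)) x = 0 := hx
  cases i with
  | zero =>
    have h0 : N x = 0 := by simpa using hx'
    rw [h0]
    exact Submodule.zero_mem _
  | succ i =>
    have hij : (i : ℤ) - ((j + 1 : ℕ) : ℤ) = k - 2 - (l : ℤ) := by
      push_cast at hp ⊢
      linarith
    refine Submodule.mem_iSup_of_mem (i, j + 1) (Submodule.mem_iSup_of_mem hij ⟨?_, y, ?_⟩)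
    · change (N ^ (i + 1)) (N x) = 0
      rw [pow_succ] at hx'
      exact hx'
    · change (N ^ (j + 1)) y = N x
      rw [pow_succ', ← hy]
      rfl
end

section
/- Let K be a field, V a finite-dimensional K-vector space, l a natural number, and N : V → V a K-linear endomorphism with N^{l+1} = 0. For every natural number k one has N^k(W_{l+k} V) ⊆ W_{l−k} V, and the K-linear map W_{l+k}V / W_{l+k−1}V → W_{l−k}V / W_{l−k−1}V induced by N^k is an isomorphism. -/
theorem wf_mem {K V : Type*} [Field K] [AddCommGroup V] [Module K V]
    (N : V →ₗ[K] V) (l : ℕ) (k : ℤ) (i j : ℕ) (h : (i : ℤ) - j = k - l) (x : V)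
    (hx : (N ^ (i + 1)) x = 0) (y : V) (hy : (N ^ j) y = x) : x ∈ weightFiltration N l k := by
  unfold weightFiltration
  refine Submodule.mem_iSup_of_mem (i, j) (Submodule.mem_iSup_of_mem h ?_)
  exact ⟨hx, y, hy⟩

theorem wf_le {K V : Type*} [Field K] [AddCommGroup V] [Module K V]
    (N : V →ₗ[K] V) (l : ℕ) (k : ℤ) (S : Submodule K V)
    (H : ∀ (i j : ℕ) (y : V), (i : ℤ) - j = k - l → (N ^ (i + 1 + j)) y = 0 → (N ^ j) y ∈ S) :
    weightFiltration N l k ≤ S := by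
  unfold weightFiltration
  refine iSup_le fun p => iSup_le fun h => ?_
  rintro x ⟨hx, y, rfl⟩
  refine H p.1 p.2 y h ?_
  rw [pow_add]
  exact hx

theorem wf_pow {K V : Type*} [Field K] [AddCommGroup V] [Module K V]
    (N : V →ₗ[K] V) (l : ℕ) (w w' : ℤ) (m : ℕ) (hw : w' = w - 2 * m) (hm : (m : ℤ) ≤ w - l + 1) :
    ∀ x ∈ weightFiltration N l w, (N ^ m) x ∈ weightFiltration N l w' := by
  refine wf_le N l w ((weightFiltration N l w').comap (N ^ m)) ?_
  intro i j y h hy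
  rw [Submodule.mem_comap, ← Module.End.mul_apply, ← pow_add]
  by_cases hi : m ≤ i
  · refine wf_mem N l w' (i - m) (m + j) (by omega) _ ?_ y rfl
    rw [← Module.End.mul_apply, ← pow_add, show i - m + 1 + (m + j) = i + 1 + j by omega, hy]
  · rw [show m + j = i + 1 + j by omega, hy]
    exact Submodule.zero_mem _

theorem wf_surj {K V : Type*} [Field K] [AddCommGroup V] [Module K V]
    (N : V →ₗ[K] V) (l : ℕ) (w w' : ℤ) (k : ℕ) (hw : w = l - k) (hw' : w' = l + k) :
    ∀ x ∈ weightFiltration N l w, ∃ y ∈ weightFiltration N l w', (N ^ k) y = x := by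
  refine wf_le N l w ((weightFiltration N l w').map (N ^ k)) ?_
  intro i j y h hy
  refine ⟨(N ^ i) y, ?_, ?_⟩
  · refine wf_mem N l w' (i + k) i (by omega) _ ?_ y rfl
    rw [← Module.End.mul_apply, ← pow_add, show i + k + 1 + i = i + 1 + j by omega, hy]
  · rw [← Module.End.mul_apply, ← pow_add, show k + i = j by omega]

/-- `N ^ k` maps `W (l + k)` into `W (l - k)`, and the induced map
`W (l+k) / W (l+k-1) → W (l-k) / W (l-k-1)` is an isomorphism: the composition of `N ^ k`
restricted to `W (l + k)` with the projection onto `W (l-k) / W (l-k-1)` is surjective with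
kernel exactly `W (l + k - 1)`. -/
theorem weightFiltration_hardLefschetz {K V : Type*} [Field K] [AddCommGroup V] [Module K V]
    [FiniteDimensional K V] (N : V →ₗ[K] V) (l : ℕ) (hN : N ^ (l + 1) = 0) (k : ℕ) :
    ∃ h : ∀ x ∈ weightFiltration N l ((l : ℤ) + k), (N ^ k) x ∈ weightFiltration N l ((l : ℤ) - k),
      Function.Surjective
        (((weightFiltration N l ((l : ℤ) - k - 1)).comap
            (weightFiltration N l ((l : ℤ) - k)).subtype).mkQ.comp ((N ^ k).restrict h)) ∧
      LinearMap.ker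
        (((weightFiltration N l ((l : ℤ) - k - 1)).comap
            (weightFiltration N l ((l : ℤ) - k)).subtype).mkQ.comp ((N ^ k).restrict h)) =
        (weightFiltration N l ((l : ℤ) + k - 1)).comap
          (weightFiltration N l ((l : ℤ) + k)).subtype := by
  have h := wf_pow N l ((l : ℤ) + k) ((l : ℤ) - k) k (by ring) (by omega)
  refine ⟨h, ?_, ?_⟩
  · intro q
    obtain ⟨⟨x, hx⟩, rfl⟩ := Submodule.mkQ_surjective _ q
    obtain ⟨y, hy, rfl⟩ := wf_surj N l _ ((l : ℤ) + k) k rfl rfl x hx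
    exact ⟨⟨y, hy⟩, rfl⟩
  · rw [LinearMap.ker_comp, Submodule.ker_mkQ]
    ext ⟨x, hx⟩
    change (N ^ k) x ∈ weightFiltration N l ((l : ℤ) - k - 1) ↔
      x ∈ weightFiltration N l ((l : ℤ) + k - 1)
    constructor
    · intro hxk
      obtain ⟨y, hy, hyx⟩ := wf_surj N l _ ((l : ℤ) + (k + 1 : ℕ)) (k + 1)
        (by push_cast; ring) rfl _ hxk
      have hNy := wf_pow N l _ ((l : ℤ) + k - 1) 1 (by push_cast; ring) (by omega) y hy
      rw [pow_one] at hNy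
      rw [pow_succ, Module.End.mul_apply] at hyx
      have h0 : (N ^ k) (x - N y) = 0 := by rw [map_sub, hyx, sub_self]
      have h1 : x - N y ∈ weightFiltration N l ((l : ℤ) + k - 1) := by
        rcases k with _ | k
        · rw [pow_zero, Module.End.one_apply] at h0
          rw [h0]
          exact Submodule.zero_mem _
        · exact wf_mem N l _ k 0 (by push_cast; ring) _ h0 (x - N y) (by simp)
      simpa using Submodule.add_mem _ h1 hNy
    · exact wf_pow N l _ _ k (by ring) (by omega) x
end

section
/- Let K be a field, V a finite-dimensional K-vector space, l a natural number, and N : V → V a K-linear endomorphism with N^{l+1} = 0. Suppose W' is a family of subspaces of V indexed by integers k such that: (i) W'_k ⊆ W'_{k+1} for all k; (ii) W'_k = 0 for k < 0 and W'_k = V for k ≥ 2l; (iii) N(W'_k) ⊆ W'_{k−2} for all k; and (iv) for every natural number k the map W'_{l+k}/W'_{l+k−1} → W'_{l−k}/W'_{l−k−1} induced by N^k is an isomorphism. Then W'_k equals Deligne's weight filtration W_k V of N centered at l, for every integer k. -/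
/-- Uniqueness of the weight filtration: any increasing filtration `W'` which vanishes in
negative degrees, is everything in degrees `≥ 2l`, is shifted by `-2` under `N`, and for which
`N ^ k` induces isomorphisms `W'(l+k)/W'(l+k-1) ≅ W'(l-k)/W'(l-k-1)`, coincides with Deligne's
weight filtration of `N` centered at `l`. -/
theorem weightFiltration_unique {K V : Type*} [Field K] [AddCommGroup V] [Module K V]
    [FiniteDimensional K V] (N : V →ₗ[K] V) (l : ℕ) (hN : N ^ (l + 1) = 0)
    (W' : ℤ → Submodule K V)
    (h₁ : ∀ k : ℤ, W' k ≤ W' (k + 1))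
    (h₂ : ∀ k : ℤ, k < 0 → W' k = ⊥)
    (h₃ : ∀ k : ℤ, 2 * (l : ℤ) ≤ k → W' k = ⊤)
    (h₄ : ∀ k : ℤ, Submodule.map N (W' k) ≤ W' (k - 2))
    (h₅ : ∀ (k : ℕ) (h : ∀ x ∈ W' ((l : ℤ) + k), (N ^ k) x ∈ W' ((l : ℤ) - k)),
      Function.Surjective
        (((W' ((l : ℤ) - k - 1)).comap (W' ((l : ℤ) - k)).subtype).mkQ.comp
          ((N ^ k).restrict h)) ∧
      LinearMap.ker
        (((W' ((l : ℤ) - k - 1)).comap (W' ((l : ℤ) - k)).subtype).mkQ.comp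
          ((N ^ k).restrict h)) =
        (W' ((l : ℤ) + k - 1)).comap (W' ((l : ℤ) + k)).subtype) :
    ∀ k : ℤ, W' k = weightFiltration N l k := by
  have mono : ∀ (d : ℕ) (a b : ℤ), b = a + d → W' a ≤ W' b := by
    intro d
    induction d with
    | zero => intro a b h; simp at h; rw [h]
    | succ d ih =>
      intro a b h
      have := h₁ (a + d)
      rw [h]
      push_cast
      rw [← add_assoc]
      exact (ih a _ rfl).trans this
  have hNW : ∀ (a : ℤ) (x : V), x ∈ W' a → N x ∈ W' (a - 2) := fun a x hx =>
    h₄ a (Submodule.mem_map_of_mem hx)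
  have hpow : ∀ (j : ℕ) (a b : ℤ) (x : V), b = a - 2 * j → x ∈ W' a → (N ^ j) x ∈ W' b := by
    intro j
    induction j with
    | zero => intro a b x h hx; simp at h; simpa [h] using hx
    | succ j ih =>
      intro a b x h hx
      rw [pow_succ', Module.End.mul_apply]
      have := hNW _ _ (ih a _ x rfl hx)
      rw [h]
      convert this using 2
      push_cast
      ring
  have hmap : ∀ (k : ℕ), ∀ x ∈ W' ((l : ℤ) + k), (N ^ k) x ∈ W' ((l : ℤ) - k) :=
    fun k x hx => hpow k _ _ x (by ring) hx
  have inj : ∀ (k : ℕ) (x : V), x ∈ W' ((l : ℤ) + k) → (N ^ k) x ∈ W' ((l : ℤ) - k - 1) →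
      x ∈ W' ((l : ℤ) + k - 1) := by
    intro k x hx hy
    have h := (h₅ k (hmap k)).2
    have hm : (⟨x, hx⟩ : W' ((l : ℤ) + k)) ∈
        (W' ((l : ℤ) + k - 1)).comap (W' ((l : ℤ) + k)).subtype := by
      rw [← h, LinearMap.mem_ker, LinearMap.comp_apply, Submodule.mkQ_apply,
        Submodule.Quotient.mk_eq_zero, Submodule.mem_comap]
      exact hy
    exact hm
  have surj : ∀ (k : ℕ) (y : V), y ∈ W' ((l : ℤ) - k) →
      ∃ x ∈ W' ((l : ℤ) + k), y - (N ^ k) x ∈ W' ((l : ℤ) - k - 1) := by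
    intro k y hy
    obtain ⟨x, hx⟩ := (h₅ k (hmap k)).1 (Submodule.Quotient.mk ⟨y, hy⟩)
    refine ⟨x, x.2, ?_⟩
    rw [LinearMap.comp_apply, Submodule.mkQ_apply] at hx
    have h2 := (Submodule.Quotient.eq _).1 hx.symm
    exact h2
  have powzero : ∀ (m : ℕ), l < m → N ^ m = 0 := fun m hm => pow_eq_zero_of_le hm hN
  have hker : ∀ (i d : ℕ) (x : V), (N ^ (i + 1)) x = 0 → x ∈ W' ((l : ℤ) + (i + d : ℕ)) →
      x ∈ W' ((l : ℤ) + i) := by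
    intro i d x h0
    induction d with
    | zero => intro h; exact h
    | succ d ih =>
      intro h
      apply ih
      have h3 : (N ^ (i + (d + 1))) x = 0 := by
        rw [show i + (d + 1) = d + (i + 1) by ring, pow_add, Module.End.mul_apply, h0, map_zero]
      have := inj _ x h (by rw [h3]; exact zero_mem _)
      convert this using 2
      push_cast
      ring
  have hker' : ∀ (i : ℕ) (x : V), (N ^ (i + 1)) x = 0 → x ∈ W' ((l : ℤ) + i) := by
    intro i x h0
    refine hker i l x h0 ?_
    rw [h₃ _ (by push_cast; omega)]
    trivial
  have image : ∀ (d k : ℕ), l < k + d → ∀ y ∈ W' ((l : ℤ) - k),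
      ∃ x ∈ W' ((l : ℤ) + k), (N ^ k) x = y := by
    intro d
    induction d with
    | zero =>
      intro k hk y hy
      rw [h₂ _ (by omega), Submodule.mem_bot] at hy
      exact ⟨0, zero_mem _, by rw [hy, map_zero]⟩
    | succ d ih =>
      intro k hk y hy
      obtain ⟨x, hx, hxy⟩ := surj k y hy
      obtain ⟨z, hz, hzy⟩ := ih (k + 1) (by omega) (y - (N ^ k) x)
        (by convert hxy using 2; push_cast; ring)
      refine ⟨x + N z, add_mem hx ?_, ?_⟩
      · exact mono 1 _ _ (by push_cast; ring) (hNW _ _ hz)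
      · rw [map_add, ← Module.End.mul_apply, ← pow_succ, hzy]
        abel
  have le_wt : ∀ (k : ℤ) (i j : ℕ) (x : V), (i : ℤ) - j = k - l → (N ^ (i + 1)) x = 0 →
      x ∈ LinearMap.range (N ^ j) → x ∈ weightFiltration N l k := by
    intro k i j x h hx hy
    have : LinearMap.ker (N ^ (i + 1)) ⊓ LinearMap.range (N ^ j) ≤ weightFiltration N l k :=
      le_iSup₂_of_le (f := fun (p : ℕ × ℕ) (_ : (p.1 : ℤ) - (p.2 : ℤ) = k - (l : ℤ)) =>
        LinearMap.ker (N ^ (p.1 + 1)) ⊓ LinearMap.range (N ^ p.2)) (i, j) h le_rfl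
    exact this ⟨hx, hy⟩
  have wtN : ∀ (k : ℤ) (x : V), x ∈ weightFiltration N l k →
      N x ∈ weightFiltration N l (k - 2) := by
    intro k x hx
    have : weightFiltration N l k ≤ (weightFiltration N l (k - 2)).comap N := by
      refine iSup₂_le ?_
      rintro ⟨i, j⟩ h y ⟨hy, z, hz⟩
      simp only at h
      rw [Submodule.mem_comap]
      have hy' : (N ^ (i + 1)) y = 0 := hy
      cases i with
      | zero =>
        have : N y = 0 := by simpa using hy'
        rw [this]
        exact zero_mem _
      | succ i =>
        refine le_wt _ i (j + 1) _ (by push_cast at h ⊢; linarith) ?_ ⟨z, ?_⟩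
        · rw [← Module.End.mul_apply, ← pow_succ]; exact hy'
        · rw [pow_succ', Module.End.mul_apply, hz]
    exact this hx
  have wtNpow : ∀ (j : ℕ) (a b : ℤ) (x : V), b = a - 2 * j → x ∈ weightFiltration N l a →
      (N ^ j) x ∈ weightFiltration N l b := by
    intro j
    induction j with
    | zero => intro a b x h hx; simp at h; simpa [h] using hx
    | succ j ih =>
      intro a b x h hx
      rw [pow_succ', Module.End.mul_apply]
      have := wtN _ _ (ih a _ x rfl hx)
      rw [h]
      convert this using 2
      push_cast
      ring
  have upper : ∀ (d k : ℕ), l ≤ k + d → ∀ x ∈ W' ((l : ℤ) + k),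
      x ∈ weightFiltration N l ((l : ℤ) + k) := by
    intro d
    induction d with
    | zero =>
      intro k hk x hx
      refine le_wt _ k 0 x (by push_cast; ring) ?_ ⟨x, by simp⟩
      rw [powzero _ (by omega), LinearMap.zero_apply]
    | succ d ih =>
      intro k hk x hx
      obtain ⟨z, hz, hzx⟩ := image l (k + 2) (by omega) ((N ^ (k + 1)) x)
        (hpow _ _ _ _ (by push_cast; ring) hx)
      have h1 := wtN _ _ (ih (k + 2) (by omega) z hz)
      have h2 : x - N z ∈ weightFiltration N l ((l : ℤ) + k) := by
        refine le_wt _ k 0 _ (by push_cast; ring) ?_ ⟨x - N z, by simp⟩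
        rw [map_sub, ← Module.End.mul_apply (N ^ (k + 1)) N z, ← pow_succ, hzx, sub_self]
      have h3 : N z ∈ weightFiltration N l ((l : ℤ) + k) := by
        convert h1 using 2
        push_cast
        ring
      simpa using add_mem h2 h3
  intro k
  apply le_antisymm
  · intro x hx
    rcases le_total (l : ℤ) k with h | h
    · obtain ⟨m, hm⟩ := Int.eq_ofNat_of_zero_le (sub_nonneg.2 h)
      obtain rfl : k = (l : ℤ) + m := by omega
      exact upper l m (by omega) x hx
    · obtain ⟨m, hm⟩ := Int.eq_ofNat_of_zero_le (sub_nonneg.2 h)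
      obtain rfl : k = (l : ℤ) - m := by omega
      obtain ⟨z, hz, rfl⟩ := image (l + 1) m (by omega) x hx
      exact wtNpow m _ _ z (by ring) (upper l m (by omega) z hz)
  · refine iSup₂_le ?_
    rintro ⟨i, j⟩ h y ⟨hy, z, hz⟩
    simp only at h
    have hy' : (N ^ (i + 1)) y = 0 := hy
    subst hz
    have h4 := hker' (i + j) z (by
      rw [show i + j + 1 = (i + 1) + j by ring, pow_add, Module.End.mul_apply]; exact hy')
    exact hpow j _ _ z (by push_cast; linarith) h4
end

section
/- Let K be a field, V a finite-dimensional K-vector space, l a positive natural number, and N : V → V a K-linear endomorphism with N^{l+1} = 0 and N^l ≠ 0 (i.e. the index of nilpotency of N is exactly l). Then Deligne's weight filtration of N centered at l has nonzero top and bottom graded pieces: W_0 V ≠ 0 and W_{2l−1} V ≠ V. -/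
/-- If the index of nilpotency of `N` is exactly `l > 0`, then the bottom and top graded pieces
of the weight filtration centered at `l` are nonzero: `W 0 ≠ 0` and `W (2l - 1) ≠ V`. -/
theorem weightFiltration_extreme_graded_pieces_ne_zero {K V : Type*} [Field K] [AddCommGroup V]
    [Module K V] [FiniteDimensional K V] (N : V →ₗ[K] V) (l : ℕ) (hl : 0 < l)
    (hN : N ^ (l + 1) = 0) (hN' : N ^ l ≠ 0) :
    weightFiltration N l 0 ≠ ⊥ ∧ weightFiltration N l (2 * (l : ℤ) - 1) ≠ ⊤ := by
  constructor
  · intro h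
    apply hN'
    rw [← LinearMap.range_eq_bot, eq_bot_iff, ← h]
    refine le_trans (le_inf ?_ le_rfl)
      (le_iSup₂_of_le (f := fun (p : ℕ × ℕ) (_ : (p.1 : ℤ) - (p.2 : ℤ) = 0 - (l : ℤ)) =>
        LinearMap.ker (N ^ (p.1 + 1)) ⊓ LinearMap.range (N ^ p.2)) (0, l) (by simp) le_rfl)
    rintro _ ⟨x, rfl⟩
    rw [LinearMap.mem_ker, ← Module.End.mul_apply, ← pow_add,
      show 0 + 1 + l = l + 1 by omega, hN, LinearMap.zero_apply]
  · intro h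
    apply hN'
    rw [← LinearMap.ker_eq_top, eq_top_iff, ← h]
    refine iSup₂_le ?_
    rintro ⟨i, j⟩ hij x ⟨hx, y, rfl⟩
    simp only at hij hx ⊢
    rcases Nat.eq_zero_or_pos j with rfl | hj
    · have : i + 1 = l := by omega
      rwa [this] at hx
    · rw [LinearMap.mem_ker, ← Module.End.mul_apply, ← pow_add,
        pow_eq_zero_of_le (by omega) hN, LinearMap.zero_apply]
end
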